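/- Non-central limit theorem for the critical Curie–Weiss model: for each N ≥ 1 let (X_1^{(N)},…,X_N^{(N)}) be CW(1,N)-distributed and S_N = ∑_{i=1}^N X_i^{(N)}. Then the laws of S_N/N^{3/4} converge weakly, as N → ∞, to the probability measure μ on ℝ whose Lebesgue density is ρ(x) = C·exp(−x⁴/12), where C = (∫_{−∞}^{∞} exp(−x⁴/12) dx)⁻¹. -/

import Mathlib

open MeasureTheory Filter Real Topology ENNReal

/-- The spin value associated to a Boolean: `true ↦ +1`, `false ↦ -1`. -/
noncomputable def spin (b : Bool) : ℝ := if b then 1 else -1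

/-- The (unnormalized) Curie–Weiss Boltzmann weight of a configuration. -/
noncomputable def cwWeight (β : ℝ) (N : ℕ) (σ : Fin N → Bool) : ℝ :=
  Real.exp (β / (2 * N) * (∑ i, spin (σ i)) ^ 2)

/-- The Curie–Weiss partition function. -/
noncomputable def cwZ (β : ℝ) (N : ℕ) : ℝ :=
  ∑ σ : Fin N → Bool, cwWeight β N σ

/-- Expectation with respect to the Curie–Weiss distribution `CW(β,N)`. -/
noncomputable def cwExp (β : ℝ) (N : ℕ) (f : (Fin N → Bool) → ℝ) : ℝ :=
  (∑ σ : Fin N → Bool, cwWeight β N σ * f σ) / cwZ β N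

/-- Law on `ℝ` of the observable `g` under the Curie–Weiss distribution `CW(β,N)`. -/
noncomputable def cwLaw (β : ℝ) (N : ℕ) (g : (Fin N → Bool) → ℝ) : Measure ℝ :=
  ∑ σ : Fin N → Bool, ENNReal.ofReal (cwWeight β N σ / cwZ β N) • Measure.dirac (g σ)

/-- The correlation `E_{β,N}(X_1 ⋯ X_ℓ)` of the first `ℓ` spins. -/
noncomputable def cwCorr (β : ℝ) (N ℓ : ℕ) : ℝ :=
  cwExp β N (fun σ => ∏ j ∈ Finset.univ.filter (fun j : Fin N => (j : ℕ) < ℓ), spin (σ j))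

/-- A function vanishing to first order at `0` with nonnegative second derivative on `(0, ∞)` is
nonnegative on `[0, ∞)`. -/
theorem nonneg_of_hasDerivAt_hasDerivAt_nonneg {f f' f'' : ℝ → ℝ}
    (hf : ∀ x, HasDerivAt f (f' x) x) (hf' : ∀ x, HasDerivAt f' (f'' x) x)
    (h0 : f 0 = 0) (h0' : f' 0 = 0) (h : ∀ x, 0 ≤ f'' x) {x : ℝ} (hx : 0 ≤ x) : 0 ≤ f x := by
  have hmono' : Monotone f' := monotone_of_hasDerivAt_nonneg hf' h
  have hmono : MonotoneOn f (Set.Ici 0) := by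
    refine monotoneOn_of_hasDerivWithinAt_nonneg (convex_Ici 0)
      (fun x _ => (hf x).continuousAt.continuousWithinAt)
      (fun x _ => (hf x).hasDerivWithinAt) fun x hx => ?_
    rw [interior_Ici, Set.mem_Ioi] at hx
    exact h0' ▸ hmono' hx.le
  exact h0 ▸ hmono Set.self_mem_Ici hx hx

theorem hasDerivAt_half_sq_sub_log_cosh (u : ℝ) :
    HasDerivAt (fun u => u ^ 2 / 2 - log (cosh u)) (u - sinh u / cosh u) u := by
  have h := ((hasDerivAt_pow 2 u).div_const 2).sub ((Real.hasDerivAt_cosh u).log (cosh_pos u).ne')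
  convert! h using 1
  norm_num

theorem hasDerivAt_sub_sinh_div_cosh (u : ℝ) :
    HasDerivAt (fun u => u - sinh u / cosh u) ((sinh u / cosh u) ^ 2) u := by
  have hc := (cosh_pos u).ne'
  have h := (hasDerivAt_id u).sub ((Real.hasDerivAt_sinh u).div (Real.hasDerivAt_cosh u) hc)
  convert! h using 1
  field_simp
  ring

theorem sq_sinh_div_cosh_le (u : ℝ) : (sinh u / cosh u) ^ 2 ≤ u ^ 2 := by
  have hderiv (x : ℝ) := hasDerivAt_sub_sinh_div_cosh x
  have hmono : Monotone fun u : ℝ => u - sinh u / cosh u :=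
    monotone_of_hasDerivAt_nonneg hderiv fun x => sq_nonneg _
  have hnonneg (v : ℝ) (hv : 0 ≤ v) : (sinh v / cosh v) ^ 2 ≤ v ^ 2 := by
    have h1 := hmono hv
    simp only [sinh_zero, zero_div, sub_zero] at h1
    exact pow_le_pow_left₀ (div_nonneg (sinh_nonneg_iff.2 hv) (cosh_pos v).le) (by linarith) 2
  rcases le_total 0 u with hu | hu
  · exact hnonneg u hu
  · simpa [neg_div] using hnonneg (-u) (by linarith)

theorem sq_div_one_add_sq_le_sq_sinh_div_cosh (u : ℝ) :
    u ^ 2 / (1 + u ^ 2) ≤ (sinh u / cosh u) ^ 2 := by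
  have hs : u ^ 2 ≤ sinh u ^ 2 := by
    rcases le_total 0 u with hu | hu
    · exact pow_le_pow_left₀ hu (self_le_sinh_iff.2 hu) 2
    · have := sinh_le_self_iff.2 hu
      nlinarith
  rw [div_pow, cosh_sq, div_le_div_iff₀ (by positivity) (by positivity)]
  linarith

theorem half_sq_sub_log_cosh_le (u : ℝ) : u ^ 2 / 2 - log (cosh u) ≤ u ^ 4 / 12 := by
  wlog hu : 0 ≤ u generalizing u
  · simpa [Even.neg_pow (by decide : Even 4)] using this (-u) (by linarith)
  have hf (x : ℝ) : HasDerivAt (fun u => u ^ 4 / 12 - (u ^ 2 / 2 - log (cosh u)))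
      (x ^ 3 / 3 - (x - sinh x / cosh x)) x := by
    convert! ((hasDerivAt_pow 4 x).div_const 12).sub (hasDerivAt_half_sq_sub_log_cosh x) using 1
    norm_num
    ring
  have hf' (x : ℝ) : HasDerivAt (fun x => x ^ 3 / 3 - (x - sinh x / cosh x))
      (x ^ 2 - (sinh x / cosh x) ^ 2) x := by
    convert! ((hasDerivAt_pow 3 x).div_const 3).sub (hasDerivAt_sub_sinh_div_cosh x) using 1
    norm_num
  have := nonneg_of_hasDerivAt_hasDerivAt_nonneg hf hf' (by simp) (by simp)
    (fun x => sub_nonneg.2 (sq_sinh_div_cosh_le x)) hu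
  linarith

theorem le_half_sq_sub_log_cosh (u : ℝ) :
    u ^ 4 / (12 * (1 + u ^ 2)) ≤ u ^ 2 / 2 - log (cosh u) := by
  wlog hu : 0 ≤ u generalizing u
  · simpa [Even.neg_pow (by decide : Even 4)] using this (-u) (by linarith)
  have hne (x : ℝ) : 1 + x ^ 2 ≠ 0 := by positivity
  have hsq (x : ℝ) : HasDerivAt (fun x : ℝ => 1 + x ^ 2) (2 * x) x := by
    simpa using (hasDerivAt_pow 2 x).const_add 1
  have hf (x : ℝ) : HasDerivAt
      (fun u => u ^ 2 / 2 - log (cosh u) - u ^ 4 / (12 * (1 + u ^ 2)))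
      (x - sinh x / cosh x - (x - x / (1 + x ^ 2) ^ 2) / 6) x := by
    convert! (hasDerivAt_half_sq_sub_log_cosh x).sub
      ((hasDerivAt_pow 4 x).div ((hsq x).const_mul 12) (by have := hne x; positivity)) using 1
    have := hne x
    field_simp
    norm_num
    ring
  have hf' (x : ℝ) : HasDerivAt
      (fun x => x - sinh x / cosh x - (x - x / (1 + x ^ 2) ^ 2) / 6)
      ((sinh x / cosh x) ^ 2 - (1 - (1 - 3 * x ^ 2) / (1 + x ^ 2) ^ 3) / 6) x := by
    convert! (hasDerivAt_sub_sinh_div_cosh x).sub (((hasDerivAt_id x).sub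
      ((hasDerivAt_id x).div ((hsq x).pow 2) (pow_ne_zero 2 (hne x)))).div_const 6) using 1
    have := hne x
    simp only [id_eq, Pi.pow_apply]
    field_simp
    norm_num
    ring
  have hf'' (x : ℝ) :
      0 ≤ (sinh x / cosh x) ^ 2 - (1 - (1 - 3 * x ^ 2) / (1 + x ^ 2) ^ 3) / 6 := by
    have h1 := sq_div_one_add_sq_le_sq_sinh_div_cosh x
    have h2 : x ^ 2 / (1 + x ^ 2) - (1 - (1 - 3 * x ^ 2) / (1 + x ^ 2) ^ 3) / 6
        = (9 * x ^ 4 + 5 * x ^ 6) / (6 * (1 + x ^ 2) ^ 3) := by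
      have := hne x
      field_simp
      ring
    have h3 : 0 ≤ (9 * x ^ 4 + 5 * x ^ 6) / (6 * (1 + x ^ 2) ^ 3) := by positivity
    linarith
  have := nonneg_of_hasDerivAt_hasDerivAt_nonneg hf hf' (by simp) (by simp) hf'' hu
  linarith

/-- The density, up to normalization, of `S_N / N^(3/4) + Z / N^(1/4)` under `CW(1,N)`, where
`a = N^(1/4)` and `Z` is an independent standard Gaussian. -/
noncomputable def cwKernel (a : ℝ) (N : ℕ) (t : ℝ) : ℝ :=
  exp (-(a ^ 2 * t ^ 2 / 2)) * cosh (t / a) ^ N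

theorem continuous_cwKernel (a : ℝ) (N : ℕ) : Continuous (cwKernel a N) := by
  have := Real.continuous_cosh
  unfold cwKernel
  fun_prop

theorem cwKernel_eq_exp {a : ℝ} {N : ℕ} (ha : 0 < a) (hN : (N : ℝ) = a ^ 4) (t : ℝ) :
    cwKernel a N t = exp (-(N * ((t / a) ^ 2 / 2 - log (cosh (t / a))))) := by
  have h : -(N * ((t / a) ^ 2 / 2 - log (cosh (t / a))))
      = -(a ^ 2 * t ^ 2 / 2) + N * log (cosh (t / a)) := by
    rw [hN]
    field_simp
    ring
  rw [h, exp_add, exp_nat_mul, exp_log (cosh_pos _), cwKernel]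

theorem exp_le_cwKernel {a : ℝ} {N : ℕ} (ha : 0 < a) (hN : (N : ℝ) = a ^ 4) (t : ℝ) :
    exp (-(t ^ 4) / 12) ≤ cwKernel a N t := by
  rw [cwKernel_eq_exp ha hN, exp_le_exp]
  have h := mul_le_mul_of_nonneg_left (half_sq_sub_log_cosh_le (t / a)) N.cast_nonneg
  have h2 : (N : ℝ) * ((t / a) ^ 4 / 12) = t ^ 4 / 12 := by
    rw [hN]
    field_simp
  linarith

theorem cwKernel_le_exp {a : ℝ} {N : ℕ} (ha : 0 < a) (hN : (N : ℝ) = a ^ 4) (t : ℝ) :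
    cwKernel a N t ≤ exp (-(t ^ 4) / (12 * (1 + t ^ 2 / a ^ 2))) := by
  rw [cwKernel_eq_exp ha hN, exp_le_exp]
  have h := mul_le_mul_of_nonneg_left (le_half_sq_sub_log_cosh (t / a)) N.cast_nonneg
  have h2 : (N : ℝ) * ((t / a) ^ 4 / (12 * (1 + (t / a) ^ 2)))
      = t ^ 4 / (12 * (1 + t ^ 2 / a ^ 2)) := by
    rw [hN]
    field_simp
  rw [neg_div]
  linarith

theorem cwKernel_le_exp_quadratic {a : ℝ} {N : ℕ} (ha : 1 ≤ a) (hN : (N : ℝ) = a ^ 4) (t : ℝ) :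
    cwKernel a N t ≤ exp (1 / 12) * exp (-(1 / 12) * t ^ 2) := by
  refine (cwKernel_le_exp (by positivity) hN t).trans ?_
  rw [← exp_add, exp_le_exp]
  have h1 : t ^ 2 / a ^ 2 ≤ t ^ 2 := div_le_self (sq_nonneg t) (one_le_pow₀ ha)
  have h2 : 0 ≤ t ^ 2 / a ^ 2 := by positivity
  rw [div_le_iff₀ (by positivity)]
  nlinarith [mul_nonneg (sq_nonneg t) (sub_nonneg.2 h1), sq_nonneg t]

theorem tendsto_cwKernel {a : ℕ → ℝ} (ha : Tendsto a atTop atTop)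
    (hN : ∀ N : ℕ, (N : ℝ) = a N ^ 4) (t : ℝ) :
    Tendsto (fun N => cwKernel (a N) N t) atTop (𝓝 (exp (-(t ^ 4) / 12))) := by
  have hlim : Tendsto (fun N => exp (-(t ^ 4) / (12 * (1 + t ^ 2 / a N ^ 2)))) atTop
      (𝓝 (exp (-(t ^ 4) / 12))) := by
    have h1 : Tendsto (fun N => t ^ 2 / a N ^ 2) atTop (𝓝 0) :=
      ((tendsto_pow_atTop two_ne_zero).comp ha).const_div_atTop _
    have h2 := (tendsto_const_nhds (x := -(t ^ 4))).div ((h1.const_add 1).const_mul 12)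
      (by norm_num)
    simp only [add_zero, mul_one] at h2
    exact (Real.continuous_exp.tendsto _).comp h2
  have hpos := ha.eventually_gt_atTop 0
  exact tendsto_of_tendsto_of_tendsto_of_le_of_le' tendsto_const_nhds hlim
    (hpos.mono fun N h => exp_le_cwKernel h (hN N) t)
    (hpos.mono fun N h => cwKernel_le_exp h (hN N) t)

theorem integrable_exp_neg_pow_four_div : Integrable fun t : ℝ => exp (-(t ^ 4) / 12) := by
  refine ((integrable_exp_neg_mul_sq (b := 1 / 12) (by norm_num)).const_mul (exp (1 / 12))).mono'
    (by fun_prop) (.of_forall fun t => ?_)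
  rw [norm_of_nonneg (exp_pos _).le]
  exact (exp_le_cwKernel one_pos (by norm_num) t).trans
    (cwKernel_le_exp_quadratic (N := 1) le_rfl (by norm_num) t)

theorem tendsto_integral_cwKernel {a : ℕ → ℝ} (ha : Tendsto a atTop atTop)
    (hN : ∀ N : ℕ, (N : ℝ) = a N ^ 4) (ξ : ℝ) :
    Tendsto (fun N => ∫ t : ℝ, Complex.exp (ξ * t * Complex.I) * (cwKernel (a N) N t : ℂ)) atTop
      (𝓝 (∫ t : ℝ, Complex.exp (ξ * t * Complex.I) * (exp (-(t ^ 4) / 12) : ℂ))) := by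
  refine tendsto_integral_filter_of_dominated_convergence
    (fun t => exp (1 / 12) * exp (-(1 / 12) * t ^ 2)) (.of_forall fun N => ?_) ?_
    ((integrable_exp_neg_mul_sq (by norm_num)).const_mul _) (.of_forall fun t => ?_)
  · have := continuous_cwKernel (a N) N
    exact Continuous.aestronglyMeasurable (by fun_prop)
  · filter_upwards [ha.eventually_ge_atTop 1] with N h
    refine .of_forall fun t => ?_
    rw [norm_mul, ← Complex.ofReal_mul, Complex.norm_exp_ofReal_mul_I, one_mul, Complex.norm_real,
      norm_of_nonneg ((exp_pos _).le.trans (exp_le_cwKernel (by positivity) (hN N) t))]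
    exact cwKernel_le_exp_quadratic h (hN N) t
  · exact (((Complex.continuous_ofReal.tendsto _).comp (tendsto_cwKernel ha hN t))).const_mul _

theorem sum_exp_mul_sum_spin (N : ℕ) (y : ℝ) :
    ∑ σ : Fin N → Bool, exp (y * ∑ i, spin (σ i)) = 2 ^ N * cosh y ^ N := by
  have h : ∑ b : Bool, exp (y * spin b) = 2 * cosh y := by
    rw [Fintype.sum_bool, cosh_eq]
    simp [spin]
    ring
  rw [← mul_pow, ← h, Fintype.sum_pow]
  simp_rw [Finset.mul_sum, exp_sum]

/-- Hubbard–Stratonovich transformation of the Curie–Weiss characteristic function. -/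
theorem integral_cexp_mul_cwKernel {a : ℝ} {N : ℕ} (ha : 0 < a) (hN : (N : ℝ) = a ^ 4) (ξ : ℝ) :
    ∫ t : ℝ, Complex.exp (ξ * t * Complex.I) * (cwKernel a N t : ℂ) =
      ((π / (a ^ 2 / 2) : ℂ) ^ (1 / 2 : ℂ) / 2 ^ N) * Complex.exp (-(ξ ^ 2 / (2 * a ^ 2))) *
        ∑ σ : Fin N → Bool, (cwWeight 1 N σ : ℂ) *
          Complex.exp (ξ * ((∑ i, spin (σ i)) / a ^ 3 : ℝ) * Complex.I) := by
  have haC : (a : ℂ) ≠ 0 := Complex.ofReal_ne_zero.2 ha.ne'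
  have hNC : (N : ℂ) = (a : ℂ) ^ 4 := by exact_mod_cast congrArg Complex.ofReal hN
  have hre : (-((a : ℂ) ^ 2 / 2)).re < 0 := by
    have h : -((a : ℂ) ^ 2 / 2) = ((-(a ^ 2 / 2) : ℝ) : ℂ) := by push_cast; ring
    rw [h, Complex.ofReal_re]
    have := pow_pos ha 2
    linarith
  have hintegrand (t : ℝ) : Complex.exp (ξ * t * Complex.I) * (cwKernel a N t : ℂ) =
      (1 / 2 ^ N) * ∑ σ : Fin N → Bool, Complex.exp (-((a : ℂ) ^ 2 / 2) * t ^ 2 +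
        ((∑ i, spin (σ i) : ℝ) / a + ξ * Complex.I) * t + 0) := by
    have hcosh : cosh (t / a) ^ N
        = (1 / 2 ^ N) * ∑ σ : Fin N → Bool, exp (t / a * ∑ i, spin (σ i)) := by
      rw [sum_exp_mul_sum_spin]
      field_simp
    rw [cwKernel, hcosh, mul_left_comm (exp _), Complex.ofReal_mul, mul_left_comm,
      Finset.mul_sum, Complex.ofReal_sum, Finset.mul_sum]
    push_cast
    congr 1
    refine Finset.sum_congr rfl fun σ _ => ?_
    rw [← Complex.exp_add, ← Complex.exp_add]
    congr 1
    ring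
  simp_rw [hintegrand]
  rw [integral_const_mul, integral_finsetSum _ fun σ _ => integrable_cexp_quadratic' hre _ _,
    Finset.mul_sum, Finset.mul_sum]
  refine Finset.sum_congr rfl fun σ _ => ?_
  rw [integral_cexp_quadratic hre, neg_neg, cwWeight, Complex.ofReal_exp]
  have hexp : (0 : ℂ) - ((∑ i, spin (σ i) : ℝ) / a + ξ * Complex.I) ^ 2 / (4 * -((a : ℂ) ^ 2 / 2))
      = -(ξ ^ 2 / (2 * a ^ 2)) + (((1 / (2 * N) * (∑ i, spin (σ i)) ^ 2 : ℝ) : ℂ) +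
        ξ * ((∑ i, spin (σ i)) / a ^ 3 : ℝ) * Complex.I) := by
    push_cast
    rw [hNC]
    generalize (∑ i, (spin (σ i) : ℂ)) = s
    field_simp
    linear_combination (4 * (ξ : ℂ) ^ 2 * a ^ 2) * Complex.I_sq
  rw [hexp, Complex.exp_add, Complex.exp_add]
  ring

theorem cwZ_pos (β : ℝ) (N : ℕ) : 0 < cwZ β N :=
  Finset.sum_pos (fun _ _ => exp_pos _) Finset.univ_nonempty

theorem cwWeight_div_cwZ_nonneg (β : ℝ) (N : ℕ) (σ : Fin N → Bool) :
    0 ≤ cwWeight β N σ / cwZ β N :=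
  div_nonneg (exp_pos _).le (cwZ_pos β N).le

instance isProbabilityMeasure_cwLaw (β : ℝ) (N : ℕ) (g : (Fin N → Bool) → ℝ) :
    IsProbabilityMeasure (cwLaw β N g) where
  measure_univ := by
    simp only [cwLaw, Measure.coe_finsetSum, Finset.sum_apply, Measure.smul_apply, measure_univ,
      smul_eq_mul, mul_one]
    rw [← ENNReal.ofReal_sum_of_nonneg fun σ _ => cwWeight_div_cwZ_nonneg β N σ,
      ← Finset.sum_div, ← cwZ, div_self (cwZ_pos β N).ne', ENNReal.ofReal_one]

theorem charFun_cwLaw (β : ℝ) (N : ℕ) (g : (Fin N → Bool) → ℝ) (ξ : ℝ) :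
    charFun (cwLaw β N g) ξ =
      (∑ σ, (cwWeight β N σ : ℂ) * Complex.exp (ξ * g σ * Complex.I)) / cwZ β N := by
  rw [charFun_apply_real, cwLaw, integral_finsetSum_measure fun σ _ =>
    (integrable_dirac (by simp)).smul_measure ENNReal.ofReal_ne_top, Finset.sum_div]
  refine Finset.sum_congr rfl fun σ _ => ?_
  rw [integral_smul_measure, integral_dirac,
    ENNReal.toReal_ofReal (cwWeight_div_cwZ_nonneg β N σ), Complex.real_smul, Complex.ofReal_div]
  ring

theorem charFun_cwLaw_eq_integral_div_integral {a : ℝ} {N : ℕ} (ha : 0 < a)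
    (hN : (N : ℝ) = a ^ 4) (ξ : ℝ) :
    charFun (cwLaw 1 N fun σ => (∑ i, spin (σ i)) / a ^ 3) ξ =
      Complex.exp (ξ ^ 2 / (2 * a ^ 2)) *
        ((∫ t : ℝ, Complex.exp (ξ * t * Complex.I) * (cwKernel a N t : ℂ)) /
          ∫ t : ℝ, Complex.exp ((0 : ℝ) * t * Complex.I) * (cwKernel a N t : ℂ)) := by
  have hZ : (cwZ 1 N : ℂ) ≠ 0 := Complex.ofReal_ne_zero.2 (cwZ_pos 1 N).ne'
  have hc : (π / ((a : ℂ) ^ 2 / 2)) ^ (1 / 2 : ℂ) / 2 ^ N ≠ 0 := by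
    have haC : (a : ℂ) ≠ 0 := Complex.ofReal_ne_zero.2 ha.ne'
    have hπ : (π : ℂ) ≠ 0 := Complex.ofReal_ne_zero.2 pi_ne_zero
    exact div_ne_zero (Complex.cpow_ne_zero_iff.2 (.inl (by simp [haC, hπ]))) (by simp)
  rw [charFun_cwLaw, integral_cexp_mul_cwKernel ha hN, integral_cexp_mul_cwKernel ha hN]
  have hsum : ∑ σ : Fin N → Bool, (cwWeight 1 N σ : ℂ) *
      Complex.exp ((0 : ℝ) * ((∑ i, spin (σ i)) / a ^ 3 : ℝ) * Complex.I) = cwZ 1 N := by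
    simp [cwZ]
  rw [hsum, Complex.exp_neg]
  have he := Complex.exp_ne_zero ((ξ : ℂ) ^ 2 / (2 * a ^ 2))
  simp only [Complex.ofReal_zero, ne_eq, OfNat.ofNat_ne_zero, not_false_eq_true, zero_pow,
    zero_div, neg_zero, Complex.exp_zero, mul_one]
  generalize (π / ((a : ℂ) ^ 2 / 2)) ^ (1 / 2 : ℂ) / 2 ^ N = c at hc ⊢
  generalize Complex.exp ((ξ : ℂ) ^ 2 / (2 * a ^ 2)) = e at he ⊢
  generalize (∑ σ : Fin N → Bool, _ : ℂ) = S
  field_simp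

/-- The probability measure on `ℝ` with density proportional to `exp (-x⁴/12)`. -/
noncomputable def quarticMeasure : Measure ℝ :=
  volume.withDensity fun x : ℝ =>
    ENNReal.ofReal ((∫ y : ℝ, exp (-(y ^ 4) / 12))⁻¹ * exp (-(x ^ 4) / 12))

theorem integral_exp_neg_pow_four_div_pos : 0 < ∫ y : ℝ, exp (-(y ^ 4) / 12) :=
  integral_exp_pos integrable_exp_neg_pow_four_div

instance isProbabilityMeasure_quarticMeasure : IsProbabilityMeasure quarticMeasure where
  measure_univ := by
    have hpos := integral_exp_neg_pow_four_div_pos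
    rw [quarticMeasure, withDensity_apply _ .univ, setLIntegral_univ,
      ← ofReal_integral_eq_lintegral_ofReal (integrable_exp_neg_pow_four_div.const_mul _)
        (.of_forall fun x => by positivity), integral_const_mul, inv_mul_cancel₀ hpos.ne',
      ENNReal.ofReal_one]

theorem charFun_quarticMeasure (ξ : ℝ) :
    charFun quarticMeasure ξ =
      (∫ t : ℝ, Complex.exp (ξ * t * Complex.I) * (exp (-(t ^ 4) / 12) : ℂ)) /
        ∫ t : ℝ, Complex.exp ((0 : ℝ) * t * Complex.I) * (exp (-(t ^ 4) / 12) : ℂ) := by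
  have hpos := integral_exp_neg_pow_four_div_pos
  have h0 : ∫ t : ℝ, Complex.exp ((0 : ℝ) * t * Complex.I) * (exp (-(t ^ 4) / 12) : ℂ)
      = ((∫ y : ℝ, exp (-(y ^ 4) / 12) : ℝ) : ℂ) := by
    rw [← integral_complex_ofReal]
    simp
  rw [h0, charFun_apply_real, quarticMeasure,
    integral_withDensity_eq_integral_toReal_smul (by fun_prop) (by simp), div_eq_inv_mul,
    ← integral_const_mul]
  refine integral_congr_ae (.of_forall fun x => ?_)
  simp only
  rw [ENNReal.toReal_ofReal (by positivity), Complex.real_smul, Complex.ofReal_mul,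
    Complex.ofReal_inv]
  ring

/-- Non-central limit theorem for the critical Curie–Weiss model: the laws of
`S_N / N^(3/4)` under `CW(1,N)` converge weakly to the probability measure on `ℝ`
with Lebesgue density `C · exp (-x⁴/12)`, where `C = (∫ exp (-x⁴/12) dx)⁻¹`. -/
theorem cw_nclt :
    ∀ f : BoundedContinuousFunction ℝ ℝ,
      Tendsto (fun N : ℕ =>
          ∫ x, f x ∂(cwLaw 1 N (fun σ => (∑ i, spin (σ i)) / (N : ℝ) ^ ((3 : ℝ) / 4))))
        atTop (𝓝 (∫ x, f x ∂(MeasureTheory.volume.withDensity (fun x : ℝ =>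
          ENNReal.ofReal ((∫ y : ℝ, Real.exp (-(y ^ 4) / 12))⁻¹ *
            Real.exp (-(x ^ 4) / 12)))))) := by
  let a : ℕ → ℝ := fun N => (N : ℝ) ^ ((1 : ℝ) / 4)
  have ha : Tendsto a atTop atTop :=
    (tendsto_rpow_atTop (by norm_num)).comp tendsto_natCast_atTop_atTop
  have hN (N : ℕ) : (N : ℝ) = a N ^ 4 := by
    rw [← Real.rpow_mul_natCast N.cast_nonneg]
    norm_num
  have ha3 (N : ℕ) : (N : ℝ) ^ ((3 : ℝ) / 4) = a N ^ 3 := by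
    rw [← Real.rpow_mul_natCast N.cast_nonneg]
    norm_num
  simp_rw [ha3]
  have hne : ∫ t : ℝ, Complex.exp ((0 : ℝ) * t * Complex.I) *
      (Real.exp (-(t ^ 4) / 12) : ℂ) ≠ 0 := by
    have h := charFun_quarticMeasure 0
    intro h0
    rw [h0, _root_.div_zero, charFun_zero, probReal_univ, Complex.ofReal_one] at h
    exact one_ne_zero h
  have hgauss (ξ : ℝ) : Tendsto (fun N => Complex.exp ((ξ : ℂ) ^ 2 / (2 * a N ^ 2))) atTop
      (𝓝 1) := by
    have h1 : Tendsto (fun N => ξ ^ 2 / (2 * a N ^ 2)) atTop (𝓝 0) :=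
      (((tendsto_pow_atTop two_ne_zero).comp ha).const_mul_atTop two_pos).const_div_atTop _
    have h2 := (Complex.continuous_exp.tendsto _).comp
      ((Complex.continuous_ofReal.tendsto _).comp h1)
    simpa [Function.comp_def] using h2
  refine ProbabilityMeasure.tendsto_iff_forall_integral_tendsto.1
    (ProbabilityMeasure.tendsto_iff_tendsto_charFun
      (μ := fun N => ⟨cwLaw 1 N fun σ => (∑ i, spin (σ i)) / a N ^ 3, inferInstance⟩)
      (μ₀ := ⟨quarticMeasure, inferInstance⟩) |>.2 fun ξ => ?_)
  have hlim := (hgauss ξ).mul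
    ((tendsto_integral_cwKernel ha hN ξ).div (tendsto_integral_cwKernel ha hN 0) hne)
  rw [one_mul, ← charFun_quarticMeasure] at hlim
  refine hlim.congr' ?_
  filter_upwards [ha.eventually_gt_atTop 0] with N h
  exact (charFun_cwLaw_eq_integral_div_integral h (hN N) ξ).symm
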